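/- Let E be any directed graph and K any field. Then the Jacobson radical of the Leavitt path algebra L_K(E) is zero. -/

import Mathlib

set_option synthInstance.maxHeartbeats 1000000
set_option maxHeartbeats 1000000

/-- Generators of the Leavitt path algebra: vertices, edges, and ghost edges. -/
inductive LPAGen (V E : Type) : Type
  | vertex : V → LPAGen V E
  | edge : E → LPAGen V E
  | ghost : E → LPAGen V E

/-- The defining relations of the Leavitt path algebra of the graph with vertex set `V`,
edge set `E`, and source and range maps `s r : E → V`.  The (CK2) relation is imposed at
every regular vertex, i.e. every vertex emitting finitely many but at least one edge. -/
inductive LPARel (K : Type) [Field K] {V E : Type} (s r : E → V) :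
    FreeAlgebra K (LPAGen V E) → FreeAlgebra K (LPAGen V E) → Prop
  | vertex_self (v : V) :
      LPARel K s r (FreeAlgebra.ι K (LPAGen.vertex v) * FreeAlgebra.ι K (LPAGen.vertex v))
        (FreeAlgebra.ι K (LPAGen.vertex v))
  | vertex_ne {v w : V} (h : v ≠ w) :
      LPARel K s r (FreeAlgebra.ι K (LPAGen.vertex v) * FreeAlgebra.ι K (LPAGen.vertex w)) 0
  | edge_left (e : E) :
      LPARel K s r (FreeAlgebra.ι K (LPAGen.vertex (s e)) * FreeAlgebra.ι K (LPAGen.edge e))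
        (FreeAlgebra.ι K (LPAGen.edge e))
  | edge_right (e : E) :
      LPARel K s r (FreeAlgebra.ι K (LPAGen.edge e) * FreeAlgebra.ι K (LPAGen.vertex (r e)))
        (FreeAlgebra.ι K (LPAGen.edge e))
  | ghost_left (e : E) :
      LPARel K s r (FreeAlgebra.ι K (LPAGen.vertex (r e)) * FreeAlgebra.ι K (LPAGen.ghost e))
        (FreeAlgebra.ι K (LPAGen.ghost e))
  | ghost_right (e : E) :
      LPARel K s r (FreeAlgebra.ι K (LPAGen.ghost e) * FreeAlgebra.ι K (LPAGen.vertex (s e)))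
        (FreeAlgebra.ι K (LPAGen.ghost e))
  | ck1_self (e : E) :
      LPARel K s r (FreeAlgebra.ι K (LPAGen.ghost e) * FreeAlgebra.ι K (LPAGen.edge e))
        (FreeAlgebra.ι K (LPAGen.vertex (r e)))
  | ck1_ne {e f : E} (h : e ≠ f) :
      LPARel K s r (FreeAlgebra.ι K (LPAGen.ghost e) * FreeAlgebra.ι K (LPAGen.edge f)) 0
  | ck2 (v : V) (h : {e : E | s e = v}.Finite) (hne : {e : E | s e = v}.Nonempty) :
      LPARel K s r (FreeAlgebra.ι K (LPAGen.vertex v))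
        (h.toFinset.sum fun e => FreeAlgebra.ι K (LPAGen.edge e) * FreeAlgebra.ι K (LPAGen.ghost e))

/-- The unital algebra presented by the Leavitt path algebra generators and relations
(for a graph with possibly infinitely many vertices this is the unitalization of the
Leavitt path algebra; the honest Leavitt path algebra is the non-unital subalgebra `lpa`
generated by the generators, defined below). -/
abbrev LPAU (K : Type) [Field K] {V E : Type} (s r : E → V) : Type :=
  RingQuot (LPARel K s r)

variable (K : Type) [Field K] {V E : Type} (s r : E → V)

/-- The canonical image of a generator. -/
def gen (g : LPAGen V E) : LPAU K s r :=
  RingQuot.mkAlgHom K (LPARel K s r) (FreeAlgebra.ι K g)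

def vertexEl (v : V) : LPAU K s r := gen K s r (LPAGen.vertex v)
def edgeEl (e : E) : LPAU K s r := gen K s r (LPAGen.edge e)
def ghostEl (e : E) : LPAU K s r := gen K s r (LPAGen.ghost e)

/-- The Leavitt path algebra `L_K(E)` of an arbitrary graph, realized (honestly, i.e.
without an adjoined unit) as the non-unital subalgebra generated by the vertices, edges
and ghost edges. -/
def lpa : NonUnitalSubalgebra K (LPAU K s r) :=
  NonUnitalAlgebra.adjoin K (Set.range (gen K s r))

def vertexIn (v : V) : ↥(lpa K s r) :=
  ⟨vertexEl K s r v, NonUnitalAlgebra.subset_adjoin K (Set.mem_range_self _)⟩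

def edgeIn (e : E) : ↥(lpa K s r) :=
  ⟨edgeEl K s r e, NonUnitalAlgebra.subset_adjoin K (Set.mem_range_self _)⟩

def ghostIn (e : E) : ↥(lpa K s r) :=
  ⟨ghostEl K s r e, NonUnitalAlgebra.subset_adjoin K (Set.mem_range_self _)⟩

instance lpaNonUnitalRing : NonUnitalRing ↥(lpa K s r) := inferInstance
instance lpaAddCommGroup : AddCommGroup ↥(lpa K s r) := inferInstance
instance lpaModule : Module K ↥(lpa K s r) := inferInstance

/-- A left module over a (possibly non-unital) ring `R`, packaged as a type with an
additive commutative group structure and an `R`-action satisfying the module axioms. -/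
structure LeftMod (R : Type) [NonUnitalRing R] : Type 1 where
  M : Type
  [acg : AddCommGroup M]
  sm : R → M → M
  add_sm : ∀ (a b : R) (m : M), sm (a + b) m = sm a m + sm b m
  sm_add : ∀ (a : R) (m m' : M), sm a (m + m') = sm a m + sm a m'
  mul_sm : ∀ (a b : R) (m : M), sm (a * b) m = sm a (sm b m)

attribute [instance] LeftMod.acg

/-- A simple left module over a possibly non-unital ring: the action is nontrivial
(`R M ≠ 0`) and the only `R`-stable additive subgroups are `⊥` and `⊤`. -/
def LeftMod.IsSimple {R : Type} [NonUnitalRing R] (P : LeftMod R) : Prop :=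
  (∃ (a : R) (m : P.M), P.sm a m ≠ 0) ∧
    ∀ N : AddSubgroup P.M, (∀ a : R, ∀ n ∈ N, P.sm a n ∈ N) → N = ⊥ ∨ N = ⊤

section LeavittPathAlgebra

variable {K s r}

section Relations

lemma vertexEl_mul_self (v : V) :
    vertexEl K s r v * vertexEl K s r v = vertexEl K s r v := by
  simpa [vertexEl, gen] using RingQuot.mkAlgHom_rel K (LPARel.vertex_self (K := K) (s := s) (r := r) v)

lemma vertexEl_mul_of_ne {v w : V} (h : v ≠ w) :
    vertexEl K s r v * vertexEl K s r w = 0 := by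
  simpa [vertexEl, gen] using RingQuot.mkAlgHom_rel K (LPARel.vertex_ne (K := K) (s := s) (r := r) h)

lemma vertexEl_mul_edgeEl (e : E) :
    vertexEl K s r (s e) * edgeEl K s r e = edgeEl K s r e := by
  simpa [vertexEl, edgeEl, gen] using
    RingQuot.mkAlgHom_rel K (LPARel.edge_left (K := K) (s := s) (r := r) e)

lemma edgeEl_mul_vertexEl (e : E) :
    edgeEl K s r e * vertexEl K s r (r e) = edgeEl K s r e := by
  simpa [vertexEl, edgeEl, gen] using
    RingQuot.mkAlgHom_rel K (LPARel.edge_right (K := K) (s := s) (r := r) e)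

lemma vertexEl_mul_ghostEl (e : E) :
    vertexEl K s r (r e) * ghostEl K s r e = ghostEl K s r e := by
  simpa [vertexEl, ghostEl, gen] using
    RingQuot.mkAlgHom_rel K (LPARel.ghost_left (K := K) (s := s) (r := r) e)

lemma ghostEl_mul_vertexEl (e : E) :
    ghostEl K s r e * vertexEl K s r (s e) = ghostEl K s r e := by
  simpa [vertexEl, ghostEl, gen] using
    RingQuot.mkAlgHom_rel K (LPARel.ghost_right (K := K) (s := s) (r := r) e)

lemma ghostEl_mul_edgeEl_self (e : E) :
    ghostEl K s r e * edgeEl K s r e = vertexEl K s r (r e) := by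
  simpa [vertexEl, edgeEl, ghostEl, gen] using
    RingQuot.mkAlgHom_rel K (LPARel.ck1_self (K := K) (s := s) (r := r) e)

lemma ghostEl_mul_edgeEl_of_ne {e f : E} (h : e ≠ f) :
    ghostEl K s r e * edgeEl K s r f = 0 := by
  simpa [edgeEl, ghostEl, gen] using
    RingQuot.mkAlgHom_rel K (LPARel.ck1_ne (K := K) (s := s) (r := r) h)

lemma vertexEl_eq_sum (v : V) (h : {e : E | s e = v}.Finite) (hne : {e : E | s e = v}.Nonempty) :
    vertexEl K s r v = ∑ e ∈ h.toFinset, edgeEl K s r e * ghostEl K s r e := by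
  simpa [vertexEl, edgeEl, ghostEl, gen, map_sum] using
    RingQuot.mkAlgHom_rel K (LPARel.ck2 (K := K) (s := s) (r := r) v h hne)

lemma vertexEl_mul_edgeEl_of_ne {v : V} {e : E} (h : s e ≠ v) :
    vertexEl K s r v * edgeEl K s r e = 0 := by
  rw [← vertexEl_mul_edgeEl, ← mul_assoc, vertexEl_mul_of_ne h.symm, zero_mul]

lemma ghostEl_mul_vertexEl_of_ne {v : V} {e : E} (h : s e ≠ v) :
    ghostEl K s r e * vertexEl K s r v = 0 := by
  rw [← ghostEl_mul_vertexEl, mul_assoc, vertexEl_mul_of_ne h, mul_zero]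

/-- The universal property of `LPAU`: two algebra maps agreeing on generators are equal. -/
lemma lpau_algHom_ext {A : Type} [Semiring A] [Algebra K A] {φ ψ : LPAU K s r →ₐ[K] A}
    (h : ∀ g, φ (gen K s r g) = ψ (gen K s r g)) : φ = ψ := by
  apply RingQuot.ringQuot_ext'
  ext g
  exact h g

end Relations

section Membership

lemma gen_mem_lpa (g : LPAGen V E) : gen K s r g ∈ lpa K s r :=
  NonUnitalAlgebra.subset_adjoin K (Set.mem_range_self g)

lemma vertexEl_mem_lpa (v : V) : vertexEl K s r v ∈ lpa K s r := gen_mem_lpa _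

lemma edgeEl_mem_lpa (e : E) : edgeEl K s r e ∈ lpa K s r := gen_mem_lpa _

lemma ghostEl_mem_lpa (e : E) : ghostEl K s r e ∈ lpa K s r := gen_mem_lpa _

/-- Finite sums of vertices are eventually two-sided local units. -/
lemma eventually_local_unit {x : LPAU K s r} (hx : x ∈ lpa K s r) :
    ∀ᶠ F : Finset V in Filter.atTop,
      (∑ v ∈ F, vertexEl K s r v) * x = x ∧ x * (∑ v ∈ F, vertexEl K s r v) = x := by
  classical
  have left (F : Finset V) (v : V) (hv : v ∈ F) (x : LPAU K s r)
      (h : vertexEl K s r v * x = x) : (∑ v ∈ F, vertexEl K s r v) * x = x := by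
    rw [Finset.sum_mul, Finset.sum_eq_single_of_mem v hv, h]
    intro w _ hw
    rw [← h, ← mul_assoc, vertexEl_mul_of_ne hw, zero_mul]
  have right (F : Finset V) (v : V) (hv : v ∈ F) (x : LPAU K s r)
      (h : x * vertexEl K s r v = x) : x * (∑ v ∈ F, vertexEl K s r v) = x := by
    rw [Finset.mul_sum, Finset.sum_eq_single_of_mem v hv, h]
    intro w _ hw
    rw [← h, mul_assoc, vertexEl_mul_of_ne hw.symm, mul_zero]
  induction hx using NonUnitalAlgebra.adjoin_induction with
  | mem x hx =>
    obtain ⟨g, rfl⟩ := hx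
    have key (v w : V) (h₁ : vertexEl K s r v * gen K s r g = gen K s r g)
        (h₂ : gen K s r g * vertexEl K s r w = gen K s r g) :
        ∀ᶠ F : Finset V in Filter.atTop,
          (∑ v ∈ F, vertexEl K s r v) * gen K s r g = gen K s r g ∧
          gen K s r g * (∑ v ∈ F, vertexEl K s r v) = gen K s r g := by
      filter_upwards [Filter.eventually_ge_atTop {v, w}] with F hF
      exact ⟨left F v (hF (by simp)) _ h₁, right F w (hF (by simp)) _ h₂⟩
    cases g with
    | vertex v => exact key v v (vertexEl_mul_self v) (vertexEl_mul_self v)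
    | edge e => exact key (s e) (r e) (vertexEl_mul_edgeEl e) (edgeEl_mul_vertexEl e)
    | ghost e => exact key (r e) (s e) (vertexEl_mul_ghostEl e) (ghostEl_mul_vertexEl e)
  | add x y _ _ hx hy =>
    filter_upwards [hx, hy] with F h₁ h₂
    rw [mul_add, add_mul, h₁.1, h₁.2, h₂.1, h₂.2]
    exact ⟨rfl, rfl⟩
  | zero => simp
  | mul x y _ _ hx hy =>
    filter_upwards [hx, hy] with F h₁ h₂
    rw [← mul_assoc, h₁.1, mul_assoc, h₂.2]
    exact ⟨rfl, rfl⟩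
  | smul k x _ hx =>
    filter_upwards [hx] with F h₁
    rw [mul_smul_comm, smul_mul_assoc, h₁.1, h₁.2]
    exact ⟨rfl, rfl⟩

lemma exists_vertexEl_mul_mul_ne_zero {x : LPAU K s r} (hx : x ∈ lpa K s r) (h0 : x ≠ 0) :
    ∃ v w, vertexEl K s r v * x * vertexEl K s r w ≠ 0 := by
  by_contra! h
  obtain ⟨F, h₁, h₂⟩ := (eventually_local_unit hx).exists
  apply h0
  rw [← h₁, ← h₂, ← mul_assoc, Finset.sum_mul, Finset.sum_mul]
  refine Finset.sum_eq_zero fun v _ => ?_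
  rw [Finset.mul_sum]
  exact Finset.sum_eq_zero fun w _ => h v w

end Membership

section Paths

variable (s r) in
/-- `IsPath s r v l w` says that the list of edges `l` is a path from `v` to `w`. -/
def IsPath : V → List E → V → Prop
  | v, [], w => v = w
  | v, e :: l, w => s e = v ∧ IsPath (r e) l w

lemma isPath_append {v w : V} {l₁ l₂ : List E} :
    IsPath s r v (l₁ ++ l₂) w ↔ ∃ u, IsPath s r v l₁ u ∧ IsPath s r u l₂ w := by
  induction l₁ generalizing v with
  | nil => simp [IsPath]
  | cons e l ih => simp [IsPath, ih, and_assoc]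

lemma IsPath.unique {v w w' : V} {l : List E} (h : IsPath s r v l w) (h' : IsPath s r v l w') :
    w = w' := by
  induction l generalizing v with
  | nil => exact h.symm.trans h'
  | cons e l ih => exact ih h.2 h'.2

variable (K s r) in
/-- The element of the algebra given by the list of edges `l`, started at `v`.  It vanishes
unless `l` is a path with source `v`. -/
def pathEl (v : V) (l : List E) : LPAU K s r :=
  vertexEl K s r v * (l.map (edgeEl K s r)).prod

variable (K s r) in
/-- The adjoint of `pathEl`. -/
def ghostPathEl (v : V) (l : List E) : LPAU K s r :=
  (l.reverse.map (ghostEl K s r)).prod * vertexEl K s r v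

lemma pathEl_nil (v : V) : pathEl K s r v [] = vertexEl K s r v := by simp [pathEl]

lemma ghostPathEl_nil (v : V) : ghostPathEl K s r v [] = vertexEl K s r v := by
  simp [ghostPathEl]

lemma pathEl_cons (e : E) (l : List E) :
    pathEl K s r (s e) (e :: l) = edgeEl K s r e * pathEl K s r (r e) l := by
  simp only [pathEl, List.map_cons, List.prod_cons]
  rw [← mul_assoc, ← mul_assoc, vertexEl_mul_edgeEl, edgeEl_mul_vertexEl]

lemma ghostPathEl_cons (e : E) (l : List E) :
    ghostPathEl K s r (s e) (e :: l) = ghostPathEl K s r (r e) l * ghostEl K s r e := by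
  simp only [ghostPathEl, List.reverse_cons, List.map_append, List.prod_append, List.map_cons,
    List.prod_cons, List.map_nil, List.prod_nil, mul_one]
  rw [mul_assoc, mul_assoc, ghostEl_mul_vertexEl, vertexEl_mul_ghostEl]

lemma pathEl_append_singleton (v : V) (l : List E) (e : E) :
    pathEl K s r v (l ++ [e]) = pathEl K s r v l * edgeEl K s r e := by
  simp [pathEl, mul_assoc]

lemma vertexEl_mul_pathEl (v : V) (l : List E) :
    vertexEl K s r v * pathEl K s r v l = pathEl K s r v l := by
  rw [pathEl, ← mul_assoc, vertexEl_mul_self]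

lemma pathEl_eq_zero {v : V} {l : List E} (h : ∀ w, ¬ IsPath s r v l w) :
    pathEl K s r v l = 0 := by
  induction l generalizing v with
  | nil => exact (h v rfl).elim
  | cons e l ih =>
    by_cases hv : s e = v
    · subst hv
      rw [pathEl_cons, ih fun w hw => h w ⟨rfl, hw⟩, mul_zero]
    · rw [pathEl, List.map_cons, List.prod_cons, ← mul_assoc, vertexEl_mul_edgeEl_of_ne hv,
        zero_mul]

lemma IsPath.pathEl_mul_vertexEl {v w : V} {l : List E} (h : IsPath s r v l w) :
    pathEl K s r v l * vertexEl K s r w = pathEl K s r v l := by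
  induction l generalizing v with
  | nil => cases h; simp [pathEl_nil, vertexEl_mul_self]
  | cons e l ih =>
    obtain ⟨rfl, h⟩ := h
    rw [pathEl_cons, mul_assoc, ih h]

lemma pathEl_mul_vertexEl (v w : V) (l : List E) [Decidable (IsPath s r v l w)] :
    pathEl K s r v l * vertexEl K s r w = if IsPath s r v l w then pathEl K s r v l else 0 := by
  split_ifs with h
  · exact h.pathEl_mul_vertexEl
  by_cases h' : ∃ u, IsPath s r v l u
  · obtain ⟨u, hu⟩ := h'
    rw [← hu.pathEl_mul_vertexEl, mul_assoc, vertexEl_mul_of_ne, mul_zero]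
    rintro rfl
    exact h hu
  · rw [pathEl_eq_zero (not_exists.mp h'), zero_mul]

lemma IsPath.pathEl_append {v w : V} {l l' : List E} (h : IsPath s r v l w) :
    pathEl K s r v (l ++ l') = pathEl K s r v l * pathEl K s r w l' := by
  rw [pathEl.eq_def K s r w, ← mul_assoc, h.pathEl_mul_vertexEl]
  simp [pathEl, mul_assoc]

lemma IsPath.ghostPathEl_mul_pathEl {v w : V} {l : List E} (h : IsPath s r v l w) :
    ghostPathEl K s r v l * pathEl K s r v l = vertexEl K s r w := by
  induction l generalizing v with
  | nil => cases h; simp [pathEl_nil, ghostPathEl_nil, vertexEl_mul_self]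
  | cons e l ih =>
    obtain ⟨rfl, h⟩ := h
    rw [pathEl_cons, ghostPathEl_cons, mul_assoc, ← mul_assoc (ghostEl K s r e),
      ghostEl_mul_edgeEl_self, vertexEl_mul_pathEl, ih h]

lemma ghostPathEl_mul_pathEl_of_not_prefix {v w w' : V} {l l' : List E} (h : IsPath s r v l w)
    (h' : IsPath s r v l' w') (hlen : l.length ≤ l'.length) (hpre : ¬ l <+: l') :
    ghostPathEl K s r v l * pathEl K s r v l' = 0 := by
  induction l generalizing v l' with
  | nil => simp at hpre
  | cons e l ih =>
    cases l' with
    | nil => simp at hlen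
    | cons f l' =>
      obtain ⟨rfl, h⟩ := h
      obtain ⟨hf, h'⟩ := h'
      rw [← hf, pathEl_cons, hf, ghostPathEl_cons, mul_assoc, ← mul_assoc (ghostEl K s r e)]
      by_cases hef : e = f
      · subst hef
        rw [ghostEl_mul_edgeEl_self, vertexEl_mul_pathEl]
        exact ih h h' (by simpa using hlen) (by simpa using hpre)
      · rw [ghostEl_mul_edgeEl_of_ne hef, zero_mul, mul_zero]

lemma list_prod_mul_mem_lpa {L : List (LPAU K s r)} (hL : ∀ x ∈ L, x ∈ lpa K s r)
    {y : LPAU K s r} (hy : y ∈ lpa K s r) : L.prod * y ∈ lpa K s r := by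
  induction L with
  | nil => simpa using hy
  | cons x L ih =>
    rw [List.prod_cons, mul_assoc]
    exact mul_mem (hL x (by simp)) (ih fun z hz => hL z (by simp [hz]))

lemma mul_list_prod_mem_lpa {L : List (LPAU K s r)} (hL : ∀ x ∈ L, x ∈ lpa K s r)
    {y : LPAU K s r} (hy : y ∈ lpa K s r) : y * L.prod ∈ lpa K s r := by
  induction L generalizing y with
  | nil => simpa using hy
  | cons x L ih =>
    rw [List.prod_cons, ← mul_assoc]
    exact ih (fun z hz => hL z (by simp [hz])) (mul_mem hy (hL x (by simp)))

lemma pathEl_mem_lpa (v : V) (l : List E) : pathEl K s r v l ∈ lpa K s r := by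
  refine mul_list_prod_mem_lpa ?_ (vertexEl_mem_lpa v)
  simp only [List.mem_map]
  rintro _ ⟨e, _, rfl⟩
  exact edgeEl_mem_lpa e

lemma ghostPathEl_mem_lpa (v : V) (l : List E) : ghostPathEl K s r v l ∈ lpa K s r := by
  refine list_prod_mul_mem_lpa ?_ (vertexEl_mem_lpa v)
  simp only [List.mem_map]
  rintro _ ⟨e, _, rfl⟩
  exact ghostEl_mem_lpa e

variable (s) in
/-- No vertex passed through by the list of edges `l` emits any other edge. -/
def NoExit (l : List E) : Prop := ∀ g ∈ l, ∀ e, s e = s g → e = g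

lemma NoExit.eq_of_length_eq {v w w' : V} {l l' : List E} (hl : NoExit s l)
    (h : IsPath s r v l w) (h' : IsPath s r v l' w') (hlen : l'.length = l.length) : l' = l := by
  induction l generalizing v l' with
  | nil => simpa using hlen
  | cons e l ih =>
    cases l' with
    | nil => simp at hlen
    | cons f l' =>
      obtain ⟨rfl, h⟩ := h
      obtain ⟨hf, h'⟩ := h'
      obtain rfl := hl e (by simp) f hf
      rw [ih (fun g hg => hl g (by simp [hg])) h h' (by simpa using hlen)]

lemma NoExit.pathEl_mul_ghostPathEl {v w : V} {l : List E} (hl : NoExit s l)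
    (h : IsPath s r v l w) : pathEl K s r v l * ghostPathEl K s r v l = vertexEl K s r v := by
  induction l generalizing v with
  | nil => simp [pathEl_nil, ghostPathEl_nil, vertexEl_mul_self]
  | cons e l ih =>
    obtain ⟨rfl, h⟩ := h
    rw [pathEl_cons, ghostPathEl_cons, mul_assoc, ← mul_assoc (pathEl K s r (r e) l),
      ih (fun g hg => hl g (by simp [hg])) h, vertexEl_mul_ghostEl]
    have hs : {f : E | s f = s e} = {e} := by
      ext f
      exact ⟨hl e (by simp) f, fun h => congrArg s h⟩
    have hfin : {f : E | s f = s e}.Finite := hs ▸ Set.finite_singleton e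
    rw [vertexEl_eq_sum (s e) hfin ⟨e, rfl⟩, show hfin.toFinset = {e} by ext f; simp [← Set.mem_singleton_iff, ← hs],
      Finset.sum_singleton]

end Paths

section Radical

/-- A two-sided form of quasi-regularity: if `z` annihilates all simple left modules and lies in
the corner of the idempotent `u`, then `u + z` is left invertible in that corner. -/
lemma exists_mul_add_eq_of_annihilates {R : Type} [NonUnitalRing R] {u z : R}
    (hz : ∀ P : LeftMod R, P.IsSimple → ∀ m : P.M, P.sm z m = 0)
    (hu : u * u = u) (huz : u * z = z) (hzu : z * u = z) : ∃ y, y * (u + z) = u := by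
  by_contra! hcon
  let N₀ : AddSubgroup R :=
    { carrier := {x | ∃ y, x * u = y * (u + z)}
      zero_mem' := ⟨0, by simp⟩
      add_mem' := by
        rintro a b ⟨y, hy⟩ ⟨y', hy'⟩
        exact ⟨y + y', by rw [add_mul, hy, hy', add_mul]⟩
      neg_mem' := by
        rintro a ⟨y, hy⟩
        exact ⟨-y, by rw [neg_mul, hy, neg_mul]⟩ }
  let S : Set (AddSubgroup R) := {N | (∀ a, ∀ n ∈ N, a * n ∈ N) ∧ N₀ ≤ N ∧ u ∉ N}
  have h₀ : N₀ ∈ S := by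
    refine ⟨?_, le_rfl, ?_⟩
    · rintro a n ⟨y, hy⟩
      exact ⟨a * y, by rw [mul_assoc, hy, mul_assoc]⟩
    · rintro ⟨y, hy⟩
      exact hcon y (hy.symm.trans hu)
  obtain ⟨N, -, hN⟩ := zorn_le_nonempty₀ S (by
    intro c hc hchain N' hN'
    have hmem {x : R} : x ∈ sSup c ↔ ∃ N ∈ c, x ∈ N :=
      AddSubgroup.mem_sSup_of_directedOn ⟨N', hN'⟩ hchain.directedOn
    refine ⟨sSup c, ⟨?_, (hc hN').2.1.trans (le_sSup hN'), ?_⟩, fun _ => le_sSup⟩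
    · intro a n hn
      obtain ⟨N, hNc, hnN⟩ := hmem.mp hn
      exact hmem.mpr ⟨N, hNc, (hc hNc).1 a n hnN⟩
    · intro hu
      obtain ⟨N, hNc, huN⟩ := hmem.mp hu
      exact (hc hNc).2.2 huN) N₀ h₀
  obtain ⟨hstable, hle, huN⟩ := hN.prop
  let P : LeftMod R :=
    { M := R ⧸ N
      sm := fun a => QuotientAddGroup.map N N (AddMonoidHom.mulLeft a) (hstable a)
      add_sm := by
        intro a b m
        induction m using QuotientAddGroup.induction_on with
        | H x => exact congrArg (QuotientAddGroup.mk (s := N)) (add_mul a b x)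
      sm_add := fun a => map_add _
      mul_sm := by
        intro a b m
        induction m using QuotientAddGroup.induction_on with
        | H x => exact congrArg (QuotientAddGroup.mk (s := N)) (mul_assoc a b x) }
  have hsm (a x : R) : P.sm a (QuotientAddGroup.mk (s := N) x) =
    QuotientAddGroup.mk (s := N) (a * x) := rfl
  have hzero (x : R) : QuotientAddGroup.mk (s := N) x = 0 ↔ x ∈ N := QuotientAddGroup.eq_zero_iff x
  have hP : P.IsSimple := by
    refine ⟨⟨u, QuotientAddGroup.mk (s := N) u, ?_⟩, ?_⟩
    · rw [hsm, hu]
      exact fun h => huN ((hzero u).mp h)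
    · intro Q hQ
      let Q' : AddSubgroup R := Q.comap (QuotientAddGroup.mk' N)
      have hNQ : N ≤ Q' := by
        intro x hx
        change QuotientAddGroup.mk (s := N) x ∈ Q
        rw [(hzero x).mpr hx]
        exact Q.zero_mem
      by_cases huQ : u ∈ Q'
      · right
        rw [eq_top_iff]
        intro m _
        induction m using QuotientAddGroup.induction_on with
        | H x =>
          have h₁ : x - x * u ∈ Q' := hNQ (hle ⟨0, by rw [sub_mul, mul_assoc, hu]; simp⟩)
          have h₂ : x * u ∈ Q' := hQ x _ huQ
          have h₃ : x ∈ Q' := by simpa using Q'.add_mem h₁ h₂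
          exact h₃
      · left
        have hQS : Q' ∈ S := ⟨fun a n hn => hQ a _ hn, hle.trans hNQ, huQ⟩
        have hQN : Q' ≤ N := hN.le_of_ge hQS hNQ
        rw [eq_bot_iff]
        intro m hm
        induction m using QuotientAddGroup.induction_on with
        | H x => exact (hzero x).mpr (hQN hm)
  have hzN : z ∈ N := by
    have := hz P hP (QuotientAddGroup.mk (s := N) u)
    rw [hsm, hzu] at this
    exact (hzero z).mp this
  have huzN : u + z ∈ N := hle ⟨u, by rw [add_mul, mul_add, hu, hzu, huz]⟩
  exact huN (by simpa using N.sub_mem huzN hzN)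

end Radical

section Representations

lemma exists_self_similar (s : E → V) : ∃ f : E → E ⊕ ℕ → E ⊕ ℕ, ∃ g : E → E ⊕ ℕ → E × (E ⊕ ℕ),
    (∀ e e' k, s e = s e' → g e (f e' k) = (e', k)) ∧
    ∀ e k, s (g e k).1 = s e ∧ f (g e k).1 (g e k).2 = k := by
  have hequiv (v : V) (hv : Nonempty {e // s e = v}) :
      Nonempty ({e // s e = v} × (E ⊕ ℕ) ≃ E ⊕ ℕ) := by
    rw [← Cardinal.eq, Cardinal.mk_prod, Cardinal.lift_id, Cardinal.lift_id]
    refine Cardinal.mul_eq_right (Cardinal.aleph0_le_mk _) ?_ (Cardinal.mk_ne_zero _)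
    exact Cardinal.mk_le_of_injective (f := fun e => Sum.inl e.1)
      (Sum.inl_injective.comp Subtype.val_injective)
  obtain ⟨φ⟩ : Nonempty (∀ v, Nonempty {e // s e = v} → ({e // s e = v} × (E ⊕ ℕ) ≃ E ⊕ ℕ)) :=
    ⟨fun v hv => (hequiv v hv).some⟩
  let φ' (e : E) := (φ (s e) ⟨⟨e, rfl⟩⟩)
  refine ⟨fun e k => φ' e (⟨e, rfl⟩, k),
    fun e k => ((φ' e).symm k).map Subtype.val id, ?_, ?_⟩
  · intro e e' k h
    have key : ∀ v (h₁ : s e = v) (h₂ : s e' = v),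
        ((φ v ⟨⟨e, h₁⟩⟩).symm (φ v ⟨⟨e', h₂⟩⟩ (⟨e', h₂⟩, k))).map Subtype.val id = (e', k) := by
      intro v h₁ h₂
      simp
    have key₂ : ∀ v (h₁ : s e = v) (h₂ : s e' = v),
        ((φ v ⟨⟨e, h₁⟩⟩).symm (φ' e' (⟨e', rfl⟩, k))).map Subtype.val id = (e', k) := by
      rintro v h₁ rfl
      exact key _ h₁ rfl
    have key₃ : ∀ v (h₁ : s e = v) (h₂ : s e' = v),
        ((φ' e).symm (φ' e' (⟨e', rfl⟩, k))).map Subtype.val id = (e', k) := by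
      rintro v rfl h₂
      exact key₂ _ rfl h₂
    exact key₃ _ rfl h.symm
  · intro e k
    have key : ∀ v (hv : Nonempty {e // s e = v}) (p : {e // s e = v} × (E ⊕ ℕ)),
        φ' p.1.1 (⟨p.1.1, rfl⟩, p.2) = φ v hv p := by
      rintro v hv ⟨⟨e', rfl⟩, k'⟩
      rfl
    have h := key (s e) ⟨⟨e, rfl⟩⟩ ((φ' e).symm k)
    exact ⟨((φ' e).symm k).1.2, h.trans ((φ' e).apply_symm_apply k)⟩

open Classical in
lemma vertexEl_ne_zero (v : V) : vertexEl K s r v ≠ 0 := by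
  obtain ⟨f, g, hgf, hfg⟩ := exists_self_similar s
  let T : LPAGen V E → Module.End K (V × (E ⊕ ℕ) →₀ K)
    | .vertex v => Finsupp.linearCombination K
        fun x => if x.1 = v then Finsupp.single x 1 else 0
    | .edge e => Finsupp.linearCombination K
        fun x => if x.1 = r e then Finsupp.single (s e, f e x.2) 1 else 0
    | .ghost e => Finsupp.linearCombination K
        fun x => if x.1 = s e ∧ (g e x.2).1 = e then Finsupp.single (r e, (g e x.2).2) 1 else 0
  have hTv (v : V) (x : V × (E ⊕ ℕ)) : T (.vertex v) (Finsupp.single x 1) =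
    if x.1 = v then Finsupp.single x 1 else 0 := by simp [T]
  have hTe (e : E) (x : V × (E ⊕ ℕ)) : T (.edge e) (Finsupp.single x 1) =
    if x.1 = r e then Finsupp.single (s e, f e x.2) 1 else 0 := by simp [T]
  have hTg (e : E) (x : V × (E ⊕ ℕ)) : T (.ghost e) (Finsupp.single x 1) =
    if x.1 = s e ∧ (g e x.2).1 = e then Finsupp.single (r e, (g e x.2).2) 1 else 0 := by simp [T]
  have hext {A B : Module.End K (V × (E ⊕ ℕ) →₀ K)}
      (h : ∀ x, A (Finsupp.single x 1) = B (Finsupp.single x 1)) : A = B := by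
    refine Finsupp.lhom_ext' fun x => LinearMap.ext_ring ?_
    exact h x
  have hT : ∀ ⦃x y⦄, LPARel K s r x y → FreeAlgebra.lift K T x = FreeAlgebra.lift K T y := by
    intro x y h
    cases h with
    | ck2 v h hne =>
      rw [map_sum]
      simp only [map_mul, FreeAlgebra.lift_ι_apply]
      refine hext fun x => ?_
      rw [hTv, LinearMap.sum_apply]
      simp only [Module.End.mul_apply, hTg]
      obtain ⟨v', k⟩ := x
      split_ifs with hv
      · obtain ⟨e₀, he₀⟩ := hne
        simp only at hv
        subst hv
        obtain ⟨h₁, h₂⟩ := hfg e₀ k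
        have hk (e : E) (he : s e = v') : g e k = g e₀ k := by
          conv_lhs => rw [← h₂]
          exact hgf _ _ _ (he.trans (h₁.trans he₀).symm)
        rw [Finset.sum_eq_single (g e₀ k).1]
        · have h₃ := hk (g e₀ k).1 (h₁.trans he₀)
          rw [if_pos ⟨(h₁.trans he₀).symm, by rw [h₃]⟩, hTe, if_pos rfl]
          simp only
          rw [h₃, h₂, h₁, he₀]
        · intro e he hne
          rw [if_neg, map_zero]
          rintro ⟨_, h₄⟩
          rw [hk e (by simpa using he)] at h₄
          exact hne h₄.symm
        · intro h₄
          exact (h₄ (by simpa using h₁.trans he₀)).elim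
      · refine (Finset.sum_eq_zero fun e he => ?_).symm
        rw [if_neg, map_zero]
        rintro ⟨h₁, _⟩
        exact hv (h₁.trans (by simpa using he))
    | _ =>
      simp only [map_mul, map_zero, FreeAlgebra.lift_ι_apply]
      refine hext fun x => ?_
      simp only [Module.End.mul_apply, hTv, hTe, hTg, apply_ite (T _), map_zero, LinearMap.zero_apply]
      grind
  intro h0
  have h := congrArg (RingQuot.liftAlgHom K ⟨FreeAlgebra.lift K T, hT⟩) h0
  rw [map_zero, vertexEl, gen, RingQuot.liftAlgHom_mkAlgHom_apply, FreeAlgebra.lift_ι_apply] at h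
  have h' := LinearMap.congr_fun h (Finsupp.single (v, Sum.inr 0) 1)
  rw [hTv] at h'
  simp at h'

end Representations

section Grading

/-- The degree of a generator. -/
def genDegree : LPAGen V E → ℤ
  | .vertex _ => 0
  | .edge _ => 1
  | .ghost _ => -1

/-- The algebra map recording the degrees of homogeneous elements. -/
theorem exists_grading : ∃ φ : LPAU K s r →ₐ[K] AddMonoidAlgebra (LPAU K s r) ℤ,
    Function.Injective φ ∧
      ∀ g, φ (gen K s r g) = AddMonoidAlgebra.single (genDegree g) (gen K s r g) := by
  let T : LPAGen V E → AddMonoidAlgebra (LPAU K s r) ℤ :=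
    fun g => AddMonoidAlgebra.single (genDegree g) (gen K s r g)
  have hT : ∀ ⦃x y⦄, LPARel K s r x y → FreeAlgebra.lift K T x = FreeAlgebra.lift K T y := by
    intro x y h
    have hmul (d d' : ℤ) (a a' : LPAU K s r) : AddMonoidAlgebra.single d a *
      AddMonoidAlgebra.single d' a' = AddMonoidAlgebra.single (d + d') (a * a') :=
      AddMonoidAlgebra.single_mul_single ..
    cases h with
    | vertex_self v =>
      simp only [T, map_mul, FreeAlgebra.lift_ι_apply, hmul, genDegree]
      exact congrArg _ (vertexEl_mul_self v)
    | vertex_ne h =>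
      simp only [T, map_mul, FreeAlgebra.lift_ι_apply, hmul, genDegree, map_zero]
      exact (congrArg _ (vertexEl_mul_of_ne h)).trans (AddMonoidAlgebra.single_zero _)
    | edge_left e =>
      simp only [T, map_mul, FreeAlgebra.lift_ι_apply, hmul, genDegree]
      exact congrArg _ (vertexEl_mul_edgeEl e)
    | edge_right e =>
      simp only [T, map_mul, FreeAlgebra.lift_ι_apply, hmul, genDegree]
      exact congrArg _ (edgeEl_mul_vertexEl e)
    | ghost_left e =>
      simp only [T, map_mul, FreeAlgebra.lift_ι_apply, hmul, genDegree]
      exact congrArg _ (vertexEl_mul_ghostEl e)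
    | ghost_right e =>
      simp only [T, map_mul, FreeAlgebra.lift_ι_apply, hmul, genDegree]
      exact congrArg _ (ghostEl_mul_vertexEl e)
    | ck1_self e =>
      simp only [T, map_mul, FreeAlgebra.lift_ι_apply, hmul, genDegree]
      exact congrArg _ (ghostEl_mul_edgeEl_self e)
    | ck1_ne h =>
      simp only [T, map_mul, FreeAlgebra.lift_ι_apply, hmul, genDegree, map_zero]
      exact (congrArg _ (ghostEl_mul_edgeEl_of_ne h)).trans (AddMonoidAlgebra.single_zero _)
    | ck2 v h hne =>
      simp only [T, genDegree, map_sum, map_mul, FreeAlgebra.lift_ι_apply,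
        hmul, add_neg_cancel]
      exact (congrArg (AddMonoidAlgebra.singleAddHom 0) (vertexEl_eq_sum v h hne)).trans
        (map_sum _ _ _)
  let φ := RingQuot.liftAlgHom K ⟨FreeAlgebra.lift K T, hT⟩
  have hφ (g : LPAGen V E) : φ (gen K s r g) = T g := by
    simp only [φ, gen]
    rw [RingQuot.liftAlgHom_mkAlgHom_apply, FreeAlgebra.lift_ι_apply]
  let ε : AddMonoidAlgebra (LPAU K s r) ℤ →ₐ[K] LPAU K s r :=
    AddMonoidAlgebra.liftNCAlgHom (AlgHom.id K _) 1 fun _ _ => Commute.one_right _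
  have hε : ε.comp φ = AlgHom.id K _ := by
    apply lpau_algHom_ext
    intro g
    rw [AlgHom.comp_apply, hφ]
    exact (AddMonoidAlgebra.liftNC_single _ _ _ _).trans (mul_one _)
  refine ⟨φ, fun x y h => ?_, hφ⟩
  simpa using (DFunLike.congr_fun hε x).symm.trans
    ((congrArg ε h).trans (DFunLike.congr_fun hε y))

end Grading

section PathSums

variable (K s r) in
/-- The linear combination of the paths starting at `w` with given coefficients. -/
noncomputable def pathSum (w : V) : (List E →₀ K) →ₗ[K] LPAU K s r :=
  Finsupp.linearCombination K (pathEl K s r w)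

lemma pathSum_single (w : V) (l : List E) (k : K) :
    pathSum K s r w (Finsupp.single l k) = k • pathEl K s r w l := by
  simp [pathSum]

lemma pathSum_apply (w : V) (c : List E →₀ K) :
    pathSum K s r w c = ∑ l ∈ c.support, c l • pathEl K s r w l := by
  simp [pathSum, Finsupp.linearCombination_apply, Finsupp.sum]

open Classical in
lemma pathSum_mul_vertexEl (w u : V) (c : List E →₀ K) :
    pathSum K s r w c * vertexEl K s r u =
      pathSum K s r w (c.filter fun l => IsPath s r w l u) := by
  induction c using Finsupp.induction_linear with
  | zero => rw [Finsupp.filter_zero, map_zero, zero_mul]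
  | add c d hc hd => rw [Finsupp.filter_add, map_add, map_add, add_mul, hc, hd]
  | single l k =>
    rw [pathSum_single, smul_mul_assoc, pathEl_mul_vertexEl]
    split_ifs with h
    · rw [Finsupp.filter_single_of_pos (fun l => IsPath s r w l u) h, pathSum_single]
    · rw [Finsupp.filter_single_of_neg (fun l => IsPath s r w l u) h, map_zero, smul_zero]

lemma pathSum_mul_edgeEl (w : V) (e : E) (c : List E →₀ K) :
    pathSum K s r w c * edgeEl K s r e = pathSum K s r w (c.mapDomain (· ++ [e])) := by
  induction c using Finsupp.induction_linear with
  | zero => simp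
  | add c d hc hd => rw [Finsupp.mapDomain_add, map_add, map_add, add_mul, hc, hd]
  | single l k =>
    rw [Finsupp.mapDomain_single, pathSum_single, pathSum_single, pathEl_append_singleton,
      smul_mul_assoc]

lemma pathSum_mul_pathEl {w u : V} {c : List E →₀ K} (hc : ∀ l ∈ c.support, IsPath s r w l u)
    (τ : List E) : pathSum K s r w c * pathEl K s r u τ =
      pathSum K s r w (c.mapDomain (· ++ τ)) := by
  rw [pathSum_apply, Finset.sum_mul, Finsupp.mapDomain, Finsupp.sum, map_sum]
  refine Finset.sum_congr rfl fun l hl => ?_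
  rw [pathSum_single, (hc l hl).pathEl_append, smul_mul_assoc]

lemma ghostPathEl_mul_pathSum {w u x : V} {c : List E →₀ K} {τ : List E}
    (hc : ∀ l ∈ c.support, IsPath s r w l u) (hlen : ∀ l ∈ c.support, τ.length ≤ l.length)
    (hτ : IsPath s r w τ x) :
    ghostPathEl K s r w τ * pathSum K s r w c =
      pathSum K s r x (c.comapDomain (τ ++ ·) (List.append_right_injective τ).injOn) := by
  rw [pathSum_apply, pathSum_apply, Finset.mul_sum]
  refine (Finset.sum_of_injOn (τ ++ ·) (List.append_right_injective τ).injOn ?_ ?_ ?_).symm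
  · intro q hq
    simpa using hq
  · intro l hl hl'
    rw [mul_smul_comm, ghostPathEl_mul_pathEl_of_not_prefix hτ (hc l hl) (hlen l hl), smul_zero]
    rintro ⟨q, rfl⟩
    exact hl' ⟨q, by simpa using hl, rfl⟩
  · intro q hq
    rw [mul_smul_comm, hτ.pathEl_append, ← mul_assoc, hτ.ghostPathEl_mul_pathEl,
      vertexEl_mul_pathEl, Finsupp.comapDomain_apply]

end PathSums

section Filtration

variable (K s r) in
/-- The span of the elements `p * q` with `p` a path starting at `w` and `q` a ghost path of
length at most `n`. -/
noncomputable def ghostFiltration (w : V) : ℕ → Submodule K (LPAU K s r)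
  | 0 => LinearMap.range (pathSum K s r w)
  | n + 1 => LinearMap.range (pathSum K s r w) ⊔
      ⨆ e, (ghostFiltration w n).map (LinearMap.mulRight K (ghostEl K s r e))

lemma pathSum_mem_ghostFiltration (w : V) (n : ℕ) (c : List E →₀ K) :
    pathSum K s r w c ∈ ghostFiltration K s r w n := by
  cases n with
  | zero => exact ⟨c, rfl⟩
  | succ n => exact Submodule.mem_sup_left ⟨c, rfl⟩

lemma mem_ghostFiltration_succ {w : V} {n : ℕ} {a : LPAU K s r} :
    a ∈ ghostFiltration K s r w (n + 1) ↔ ∃ (c : List E →₀ K) (F : Finset E) (A : E → LPAU K s r),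
      (∀ e, A e ∈ ghostFiltration K s r w n) ∧
      a = pathSum K s r w c + ∑ e ∈ F, A e * ghostEl K s r e := by
  constructor
  · intro ha
    obtain ⟨_, ⟨c, rfl⟩, y, hy, rfl⟩ := Submodule.mem_sup.mp ha
    obtain ⟨f, hf, rfl⟩ := (Submodule.mem_iSup_iff_exists_finsupp _ _).mp hy
    choose A hA hA' using hf
    refine ⟨c, f.support, A, hA, ?_⟩
    congr 1
    exact Finset.sum_congr rfl fun e _ => (hA' e).symm
  · rintro ⟨c, F, A, hA, rfl⟩
    refine add_mem (pathSum_mem_ghostFiltration w _ c) (sum_mem fun e _ => ?_)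
    exact Submodule.mem_sup_right (Submodule.mem_iSup_of_mem e ⟨A e, hA e, rfl⟩)

lemma ghostFiltration_mono (w : V) : Monotone (ghostFiltration K s r w) := by
  refine monotone_nat_of_le_succ fun n => ?_
  induction n with
  | zero => exact le_sup_left
  | succ n ih => exact sup_le_sup_left (iSup_mono fun e => Submodule.map_mono ih) _

lemma mul_vertexEl_mem_ghostFiltration {w : V} {n : ℕ} {a : LPAU K s r}
    (ha : a ∈ ghostFiltration K s r w n) (u : V) :
    a * vertexEl K s r u ∈ ghostFiltration K s r w n := by
  cases n with
  | zero =>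
    obtain ⟨c, rfl⟩ := ha
    rw [pathSum_mul_vertexEl]
    exact pathSum_mem_ghostFiltration w 0 _
  | succ n =>
    obtain ⟨c, F, A, hA, rfl⟩ := mem_ghostFiltration_succ.mp ha
    rw [add_mul, pathSum_mul_vertexEl, Finset.sum_mul]
    refine add_mem (pathSum_mem_ghostFiltration w _ _) (sum_mem fun e _ => ?_)
    rw [mul_assoc]
    by_cases h : s e = u
    · rw [← h, ghostEl_mul_vertexEl]
      exact Submodule.mem_sup_right (Submodule.mem_iSup_of_mem e ⟨A e, hA e, rfl⟩)
    · rw [ghostEl_mul_vertexEl_of_ne h, mul_zero]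
      exact zero_mem _

lemma mul_edgeEl_mem_ghostFiltration {w : V} {n : ℕ} {c : List E →₀ K} {F : Finset E}
    {A : E → LPAU K s r} (hA : ∀ e, A e ∈ ghostFiltration K s r w n) (f : E) :
    (pathSum K s r w c + ∑ e ∈ F, A e * ghostEl K s r e) * edgeEl K s r f ∈
      ghostFiltration K s r w n := by
  rw [add_mul, pathSum_mul_edgeEl, Finset.sum_mul]
  refine add_mem (pathSum_mem_ghostFiltration w _ _) (sum_mem fun e _ => ?_)
  rw [mul_assoc]
  by_cases h : e = f
  · rw [h, ghostEl_mul_edgeEl_self]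
    exact mul_vertexEl_mem_ghostFiltration (hA f) _
  · rw [ghostEl_mul_edgeEl_of_ne h, mul_zero]
    exact zero_mem _

lemma exists_mem_ghostFiltration {x : LPAU K s r} (hx : x ∈ lpa K s r) (w : V) :
    ∃ n, vertexEl K s r w * x ∈ ghostFiltration K s r w n := by
  suffices h : ∀ n, ∀ y ∈ ghostFiltration K s r w n, ∃ m, y * x ∈ ghostFiltration K s r w m by
    refine h 0 _ ⟨Finsupp.single [] 1, ?_⟩
    rw [pathSum_single, one_smul, pathEl_nil]
  induction hx using NonUnitalAlgebra.adjoin_induction with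
  | mem x hx =>
    obtain ⟨g, rfl⟩ := hx
    intro n y hy
    cases g with
    | vertex v => exact ⟨n, mul_vertexEl_mem_ghostFiltration hy v⟩
    | edge e =>
      cases n with
      | zero =>
        obtain ⟨c, rfl⟩ := hy
        exact ⟨0, _, (pathSum_mul_edgeEl w e c).symm⟩
      | succ n =>
        obtain ⟨c, F, A, hA, rfl⟩ := mem_ghostFiltration_succ.mp hy
        exact ⟨n, mul_edgeEl_mem_ghostFiltration hA e⟩
    | ghost e =>
      exact ⟨n + 1, Submodule.mem_sup_right (Submodule.mem_iSup_of_mem e ⟨y, hy, rfl⟩)⟩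
  | add x x' _ _ hx hx' =>
    intro n y hy
    obtain ⟨m, hm⟩ := hx n y hy
    obtain ⟨m', hm'⟩ := hx' n y hy
    rw [mul_add]
    exact ⟨max m m', add_mem (ghostFiltration_mono w (le_max_left m m') hm)
      (ghostFiltration_mono w (le_max_right m m') hm')⟩
  | zero => exact fun n y _ => ⟨0, by rw [mul_zero]; exact zero_mem _⟩
  | mul x x' _ _ hx hx' =>
    intro n y hy
    obtain ⟨m, hm⟩ := hx n y hy
    rw [← mul_assoc]
    exact hx' m _ hm
  | smul k x _ hx =>
    intro n y hy
    obtain ⟨m, hm⟩ := hx n y hy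
    rw [mul_smul_comm]
    exact ⟨m, Submodule.smul_mem _ _ hm⟩

open Classical in
/-- Every nonzero element with a source and a range can be multiplied on the right to a nonzero
combination of honest paths. -/
lemma exists_mul_eq_pathSum {w : V} {n : ℕ} {a : LPAU K s r}
    (ha : a ∈ ghostFiltration K s r w n) (h0 : a ≠ 0) {u : V}
    (hau : a * vertexEl K s r u = a) :
    ∃ y ∈ lpa K s r, ∃ (u' : V) (c : List E →₀ K), c ≠ 0 ∧
      (∀ l ∈ c.support, IsPath s r w l u') ∧ a * y = pathSum K s r w c := by
  have base (a : LPAU K s r) (u : V) (c : List E →₀ K) (h0 : a ≠ 0)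
      (hau : a * vertexEl K s r u = a) (hc : a = pathSum K s r w c) :
      ∃ y ∈ lpa K s r, ∃ (u' : V) (c : List E →₀ K), c ≠ 0 ∧
        (∀ l ∈ c.support, IsPath s r w l u') ∧ a * y = pathSum K s r w c := by
    refine ⟨vertexEl K s r u, vertexEl_mem_lpa u, u, c.filter fun l => IsPath s r w l u, ?_, ?_, ?_⟩
    · intro hz
      rw [← hau, hc, pathSum_mul_vertexEl, hz, map_zero] at h0
      exact h0 rfl
    · intro l hl
      rw [Finsupp.support_filter, Finset.mem_filter] at hl
      exact hl.2
    · rw [hc, pathSum_mul_vertexEl]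
  induction n generalizing a u with
  | zero =>
    obtain ⟨c, rfl⟩ := ha
    exact base _ u c h0 hau rfl
  | succ n ih =>
    obtain ⟨c, F, A, hA, hsum⟩ := mem_ghostFiltration_succ.mp ha
    by_cases hedge : ∃ e, a * edgeEl K s r e ≠ 0
    · obtain ⟨e, he⟩ := hedge
      have hmem : a * edgeEl K s r e ∈ ghostFiltration K s r w n := by
        rw [hsum]
        exact mul_edgeEl_mem_ghostFiltration hA e
      have her : a * edgeEl K s r e * vertexEl K s r (r e) = a * edgeEl K s r e := by
        rw [mul_assoc, edgeEl_mul_vertexEl]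
      obtain ⟨y, hy, u', d, hd⟩ := ih hmem he her
      exact ⟨edgeEl K s r e * y, mul_mem (edgeEl_mem_lpa e) hy, u', d, by rwa [← mul_assoc]⟩
    push Not at hedge
    have hae (f : E) : pathSum K s r w c * edgeEl K s r f +
        (if f ∈ F then A f * vertexEl K s r (r f) else 0) = 0 := by
      refine Eq.trans ?_ (hedge f)
      rw [hsum, add_mul, Finset.sum_mul]
      congr 1
      refine (Finset.sum_ite_eq F f fun f => A f * vertexEl K s r (r f)).symm.trans
        (Finset.sum_congr rfl fun e _ => ?_)
      rw [mul_assoc]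
      split_ifs with h
      · rw [← h, ghostEl_mul_edgeEl_self]
      · rw [ghostEl_mul_edgeEl_of_ne (Ne.symm h), mul_zero]
    have hA' : ∀ f ∈ F, A f * ghostEl K s r f +
        pathSum K s r w c * (edgeEl K s r f * ghostEl K s r f) = 0 := by
      intro f hf
      have h := hae f
      rw [if_pos hf] at h
      rw [← vertexEl_mul_ghostEl f, ← mul_assoc, ← mul_assoc (edgeEl K s r f),
        edgeEl_mul_vertexEl, ← mul_assoc, ← add_mul, add_comm, h, zero_mul]
    have hau' : a + pathSum K s r w c * (∑ e ∈ F with s e = u, edgeEl K s r e * ghostEl K s r e) =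
        pathSum K s r w c * vertexEl K s r u := by
      nth_rw 1 [← hau, hsum]
      rw [add_mul, Finset.sum_mul, Finset.mul_sum, Finset.sum_filter, add_assoc,
        ← Finset.sum_add_distrib, Finset.sum_eq_zero, add_zero]
      intro e he
      split_ifs with h
      · rw [← h, mul_assoc, ghostEl_mul_vertexEl, hA' e he]
      · rw [mul_assoc, ghostEl_mul_vertexEl_of_ne h, mul_zero, add_zero]
    by_cases hF : ∃ f ∉ F, s f = u
    · obtain ⟨f, hfF, rfl⟩ := hF
      by_cases hz : c.filter (fun l => IsPath s r w l (s f)) = 0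
      · exfalso
        rw [pathSum_mul_vertexEl, hz, map_zero] at hau'
        apply h0
        have h : pathSum K s r w c *
            (∑ e ∈ F with s e = s f, edgeEl K s r e * ghostEl K s r e) = 0 := by
          rw [Finset.mul_sum]
          refine Finset.sum_eq_zero fun e he => ?_
          rw [← vertexEl_mul_edgeEl e, (Finset.mem_filter.mp he).2, mul_assoc, ← mul_assoc,
            pathSum_mul_vertexEl, hz, map_zero, zero_mul]
        rwa [h, add_zero] at hau'
      · have hinj : Function.Injective fun l : List E => l ++ [f] := List.append_left_injective [f]
        refine ⟨edgeEl K s r f, edgeEl_mem_lpa f, r f,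
          (c.filter fun l => IsPath s r w l (s f)).mapDomain (· ++ [f]), ?_, ?_, ?_⟩
        · exact fun h => hz (Finsupp.mapDomain_injective hinj (h.trans Finsupp.mapDomain_zero.symm))
        · intro l hl
          obtain ⟨q, hq, rfl⟩ := Finset.mem_image.mp (Finsupp.mapDomain_support hl)
          rw [Finsupp.support_filter, Finset.mem_filter] at hq
          exact isPath_append.mpr ⟨s f, hq.2, rfl, rfl⟩
        · have hf := hae f
          rw [if_neg hfF, add_zero] at hf
          rw [hedge f, ← pathSum_mul_edgeEl, ← pathSum_mul_vertexEl, mul_assoc,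
            vertexEl_mul_edgeEl, hf]
    push Not at hF
    by_cases hne : ∃ f, s f = u
    · exfalso
      have hset : {e : E | s e = u} = ((F.filter fun e => s e = u : Finset E) : Set E) := by
        ext e
        simp only [Set.mem_ofPred_eq, Finset.coe_filter]
        exact ⟨fun h => ⟨not_not.mp fun h' => hF e h' h, h⟩, And.right⟩
      have hfin : {e : E | s e = u}.Finite := hset ▸ Finset.finite_toSet _
      have hF' : hfin.toFinset = F.filter fun e => s e = u := by
        rw [← Finset.coe_inj, Set.Finite.coe_toFinset, hset]
      rw [vertexEl_eq_sum u hfin hne, hF'] at hau'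
      exact h0 (add_eq_right.mp hau')
    · push Not at hne
      rw [Finset.filter_false_of_mem fun e _ => hne e, Finset.sum_empty, mul_zero, add_zero,
        pathSum_mul_vertexEl] at hau'
      exact base a u _ h0 hau hau'

end Filtration

section Radical

lemma grading_pathEl {φ : LPAU K s r →ₐ[K] AddMonoidAlgebra (LPAU K s r) ℤ}
    (hφ : ∀ g, φ (gen K s r g) = AddMonoidAlgebra.single (genDegree g) (gen K s r g))
    (v : V) (l : List E) :
    φ (pathEl K s r v l) = AddMonoidAlgebra.single (l.length : ℤ) (pathEl K s r v l) := by
  have hmul (m n : ℤ) (x y : LPAU K s r) :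
      (AddMonoidAlgebra.single m x * AddMonoidAlgebra.single n y :
        AddMonoidAlgebra (LPAU K s r) ℤ) = AddMonoidAlgebra.single (m + n) (x * y) :=
    AddMonoidAlgebra.single_mul_single ..
  induction l using List.reverseRecOn with
  | nil =>
    rw [pathEl_nil]
    exact hφ (LPAGen.vertex v)
  | append_singleton l e ih =>
    have he : φ (edgeEl K s r e) = AddMonoidAlgebra.single 1 (edgeEl K s r e) :=
      hφ (LPAGen.edge e)
    rw [pathEl_append_singleton, map_mul, ih, he, hmul, List.length_append,
      List.length_singleton, Nat.cast_add, Nat.cast_one]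

lemma coeff_grading_pathSum {φ : LPAU K s r →ₐ[K] AddMonoidAlgebra (LPAU K s r) ℤ}
    (hφ : ∀ g, φ (gen K s r g) = AddMonoidAlgebra.single (genDegree g) (gen K s r g))
    (v : V) (d : List E →₀ K) (n : ℤ) :
    (φ (pathSum K s r v d)).coeff n =
      ∑ l ∈ d.support with (l.length : ℤ) = n, d l • pathEl K s r v l := by
  rw [pathSum_apply, map_sum, Finset.sum_filter, AddMonoidAlgebra.coeff_sum, Finsupp.finsetSum_apply]
  refine Finset.sum_congr rfl fun l _ => ?_
  rw [map_smul, grading_pathEl hφ, AddMonoidAlgebra.coeff_smul, Finsupp.smul_apply,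
    AddMonoidAlgebra.coeff_single, Finsupp.single_apply]
  split_ifs with h
  · rfl
  · rw [smul_zero]

/-- A combination of paths whose terms of extreme degree are the vertex `v` and a closed path
without exits at `v` is not left invertible in the corner at `v`. -/
lemma mul_pathSum_ne_vertexEl {v : V} {γ : List E} (hγ : IsPath s r v γ v) (hexit : NoExit s γ)
    (hne : γ ≠ []) {d : List E →₀ K} (hd₀ : d [] ≠ 0) (hdγ : d γ ≠ 0)
    (hlen : ∀ l ∈ d.support, l ≠ γ → l.length < γ.length) (y : LPAU K s r) :
    y * pathSum K s r v d ≠ vertexEl K s r v := by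
  intro hy
  obtain ⟨φ, hinj, hφ⟩ := exists_grading (K := K) (s := s) (r := r)
  have hvS : vertexEl K s r v * pathSum K s r v d = pathSum K s r v d := by
    rw [pathSum_apply, Finset.mul_sum]
    exact Finset.sum_congr rfl fun l _ => by rw [mul_smul_comm, vertexEl_mul_pathEl]
  set Y := φ (y * vertexEl K s r v) with hY
  set D := φ (pathSum K s r v d) with hD
  have hφv : φ (vertexEl K s r v) = AddMonoidAlgebra.single 0 (vertexEl K s r v) :=
    hφ (LPAGen.vertex v)
  have hYD : Y * D = AddMonoidAlgebra.single 0 (vertexEl K s r v) := by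
    rw [hY, hD, ← map_mul, mul_assoc, hvS, hy, hφv]
  have hYv (n : ℤ) : Y.coeff n * vertexEl K s r v = Y.coeff n := by
    have h : Y * AddMonoidAlgebra.single 0 (vertexEl K s r v) = Y := by
      rw [hY, ← hφv, ← map_mul, mul_assoc, vertexEl_mul_self]
    conv_rhs => rw [← h]
    exact (AddMonoidAlgebra.coeff_mul_single_zero ..).symm
  have hDsupp : ∀ n ∈ D.coeff.support, 0 ≤ n ∧ n ≤ γ.length := by
    intro n hn
    rw [Finsupp.mem_support_iff, hD, coeff_grading_pathSum hφ] at hn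
    obtain ⟨l, hl, -⟩ := Finset.exists_ne_zero_of_sum_ne_zero hn
    obtain ⟨hl', rfl⟩ := Finset.mem_filter.mp hl
    refine ⟨Int.natCast_nonneg _, ?_⟩
    by_cases h : l = γ
    · rw [h]
    · exact_mod_cast (hlen l hl' h).le
  have hD₀ : D.coeff 0 = d [] • vertexEl K s r v := by
    rw [hD, coeff_grading_pathSum hφ, Finset.sum_eq_single [], pathEl_nil]
    · intro l hl h
      simp [h] at hl
    · intro h
      simp [hd₀] at h
  have hDγ : D.coeff γ.length = d γ • pathEl K s r v γ := by
    rw [hD, coeff_grading_pathSum hφ, Finset.sum_eq_single γ]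
    · intro l hl h
      obtain ⟨hl, hl'⟩ := Finset.mem_filter.mp hl
      have := hlen l hl h
      omega
    · intro h
      simp [hdγ] at h
  have hYne : Y.coeff.support.Nonempty := by
    rw [Finsupp.support_nonempty_iff]
    intro h
    have hY0 : Y = 0 := AddMonoidAlgebra.coeff_injective h
    rw [hY0, zero_mul, ← hφv] at hYD
    exact vertexEl_ne_zero v (hinj (hYD.symm.trans (map_zero φ).symm))
  have hcoeff (n : ℤ) (hn : n ≠ 0) : (Y * D).coeff n = 0 := by
    rw [hYD, AddMonoidAlgebra.coeff_single, Finsupp.single_eq_of_ne hn]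
  have hmin : Y.coeff.support.min' hYne = 0 := by
    set m := Y.coeff.support.min' hYne with hm
    have hmem : m ∈ Y.coeff.support := Finset.min'_mem _ _
    have huniq : UniqueAdd Y.coeff.support D.coeff.support m 0 := by
      intro a b ha hb hab
      have h₁ := Finset.min'_le _ a ha
      have h₂ := (hDsupp b hb).1
      omega
    by_contra h0
    have h := AddMonoidAlgebra.coeff_mul_add_of_uniqueAdd huniq
    rw [add_zero, hcoeff m h0, hD₀, mul_smul_comm, hYv] at h
    exact Finsupp.mem_support_iff.mp hmem ((smul_eq_zero_iff_right hd₀).mp h.symm)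
  set M := Y.coeff.support.max' hYne with hM
  have hmem : M ∈ Y.coeff.support := Finset.max'_mem _ _
  have hM0 : 0 ≤ M := hmin ▸ Finset.min'_le _ M hmem
  have huniq : UniqueAdd Y.coeff.support D.coeff.support M γ.length := by
    intro a b ha hb hab
    have h₁ := Finset.le_max' _ a ha
    have h₂ := (hDsupp b hb).2
    omega
  have hpos := List.length_pos_iff.mpr hne
  have h := AddMonoidAlgebra.coeff_mul_add_of_uniqueAdd huniq
  rw [hcoeff _ (by omega), hDγ, mul_smul_comm] at h
  have h' := (smul_eq_zero_iff_right hdγ).mp h.symm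
  apply Finsupp.mem_support_iff.mp hmem
  rw [← hYv, ← hexit.pathEl_mul_ghostPathEl hγ, ← mul_assoc, h', zero_mul]

variable {J : Set (LPAU K s r)}

lemma false_of_pathSum_mem_of_noExit
    (hqr : ∀ x ∈ J, ∀ v, vertexEl K s r v * x = x → x * vertexEl K s r v = x →
      ∃ y, y * (vertexEl K s r v + x) = vertexEl K s r v)
    (hl : ∀ x ∈ J, ∀ y ∈ lpa K s r, y * x ∈ J) (hr : ∀ x ∈ J, ∀ y ∈ lpa K s r, x * y ∈ J)
    {v : V} {c : List E →₀ K} (hc : ∀ l ∈ c.support, IsPath s r v l v)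
    (hexit : ∀ l ∈ c.support, NoExit s l) (h0 : c [] ≠ 0) (hcJ : pathSum K s r v c ∈ J) :
    False := by
  classical
  obtain ⟨γ, hγ, hmax⟩ := c.support.exists_max_image List.length
    ⟨[], Finsupp.mem_support_iff.mpr h0⟩
  by_cases hne : γ = []
  · have hc' : c = Finsupp.single [] (c []) := by
      refine Finsupp.eq_single_iff.mpr ⟨fun l hl => ?_, rfl⟩
      have := hmax l hl
      rw [hne] at this
      simpa using this
    have hz := hl _ hcJ ((-(c [])⁻¹) • vertexEl K s r v)
      (SMulMemClass.smul_mem _ (vertexEl_mem_lpa v))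
    have hz' : (-(c [])⁻¹) • vertexEl K s r v * pathSum K s r v c =
        pathSum K s r v (Finsupp.single [] (-1)) := by
      rw [hc', pathSum_single, pathSum_single, pathEl_nil, smul_mul_assoc, mul_smul_comm,
        vertexEl_mul_self, smul_smul, Finsupp.single_eq_same, neg_mul, inv_mul_cancel₀ h0]
    rw [hz'] at hz
    have hv : vertexEl K s r v = pathSum K s r v (Finsupp.single [] 1) := by
      rw [pathSum_single, one_smul, pathEl_nil]
    obtain ⟨y, hy⟩ := hqr _ hz v
      (by rw [pathSum_single, mul_smul_comm, vertexEl_mul_pathEl])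
      (by rw [pathSum_single, smul_mul_assoc, pathEl_nil, vertexEl_mul_self])
    nth_rw 1 [hv] at hy
    rw [← map_add, ← Finsupp.single_add, add_neg_cancel, Finsupp.single_zero, map_zero,
      mul_zero] at hy
    exact vertexEl_ne_zero v hy.symm
  · have hinj : Function.Injective fun l : List E => l ++ γ := List.append_left_injective γ
    have hγv := hc γ hγ
    have hz := hr _ hcJ _ (pathEl_mem_lpa v γ)
    obtain ⟨y, hy⟩ := hqr _ hz v
      (by
        rw [← mul_assoc, pathSum_apply, Finset.mul_sum]
        congr 1
        exact Finset.sum_congr rfl fun l _ => by rw [mul_smul_comm, vertexEl_mul_pathEl])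
      (by rw [mul_assoc, hγv.pathEl_mul_vertexEl])
    rw [pathSum_mul_pathEl hc] at hy
    have hv : vertexEl K s r v = pathSum K s r v (Finsupp.single [] 1) := by
      rw [pathSum_single, one_smul, pathEl_nil]
    nth_rw 1 [hv] at hy
    rw [← map_add] at hy
    have hpos := List.length_pos_iff.mpr hne
    refine mul_pathSum_ne_vertexEl (γ := γ ++ γ) (isPath_append.mpr ⟨v, hγv, hγv⟩) ?_ (by simpa)
      ?_ ?_ ?_ y hy
    · intro g hg
      exact hexit γ hγ g (by simpa using hg)
    · rw [Finsupp.add_apply, Finsupp.single_eq_same, Finsupp.mapDomain_of_notMem_range, add_zero]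
      · exact one_ne_zero
      · rintro ⟨l, hl⟩
        exact hne (List.append_eq_nil_iff.mp hl).2
    · rw [Finsupp.add_apply, Finsupp.single_eq_of_ne (by simpa), zero_add,
        Finsupp.mapDomain_apply hinj _ γ]
      exact Finsupp.mem_support_iff.mp hγ
    · intro l hl hlγ
      rcases Finset.mem_union.mp (Finsupp.support_add hl) with h | h
      · rw [Finset.mem_singleton.mp (Finsupp.support_single_subset h), List.length_append]
        simpa using hpos
      · obtain ⟨q, hq, rfl⟩ := Finset.mem_image.mp (Finsupp.mapDomain_support h)
        rw [List.length_append, List.length_append]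
        refine Nat.add_lt_add_right (lt_of_le_of_ne (hmax q hq) fun h => hlγ ?_) _
        rw [(hexit γ hγ).eq_of_length_eq hγv (hc q hq) h]

lemma false_of_pathSum_mem
    (hqr : ∀ x ∈ J, ∀ v, vertexEl K s r v * x = x → x * vertexEl K s r v = x →
      ∃ y, y * (vertexEl K s r v + x) = vertexEl K s r v)
    (hl : ∀ x ∈ J, ∀ y ∈ lpa K s r, y * x ∈ J) (hr : ∀ x ∈ J, ∀ y ∈ lpa K s r, x * y ∈ J)
    {v : V} {c : List E →₀ K} (hc : ∀ l ∈ c.support, IsPath s r v l v)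
    (h0 : c [] ≠ 0) (hcJ : pathSum K s r v c ∈ J) : False := by
  classical
  induction hn : c.support.card using Nat.strong_induction_on generalizing v c with
  | _ n ih =>
  by_cases hexit : ∀ l ∈ c.support, NoExit s l
  · exact false_of_pathSum_mem_of_noExit hqr hl hr hc hexit h0 hcJ
  simp only [NoExit, not_forall] at hexit
  obtain ⟨q, hq, g, hg, e, hse, hne⟩ := hexit
  obtain ⟨σ, ρ, rfl⟩ := List.append_of_mem hg
  obtain ⟨u, hσ, rfl, -⟩ := isPath_append.mp (hc _ hq)
  set τ := σ ++ [e] with hτdef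
  have hτ : IsPath s r v τ (r e) := isPath_append.mpr ⟨_, hσ, hse, rfl⟩
  have hinj : Function.Injective fun l : List E => l ++ τ := List.append_left_injective τ
  have hinj' : Function.Injective fun l : List E => τ ++ l := List.append_right_injective τ
  set d := c.mapDomain (· ++ τ) with hd
  have hdsupp : ∀ l ∈ d.support, ∃ q ∈ c.support, q ++ τ = l := fun l hl =>
    Finset.mem_image.mp (Finsupp.mapDomain_support hl)
  have hdpath : ∀ l ∈ d.support, IsPath s r v l (r e) := by
    intro l hl
    obtain ⟨q, hq, rfl⟩ := hdsupp l hl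
    exact isPath_append.mpr ⟨v, hc q hq, hτ⟩
  have hdlen : ∀ l ∈ d.support, τ.length ≤ l.length := by
    intro l hl
    obtain ⟨q, hq, rfl⟩ := hdsupp l hl
    simp
  have hmem := hl _ (hr _ hcJ _ (pathEl_mem_lpa v τ)) _ (ghostPathEl_mem_lpa v τ)
  rw [pathSum_mul_pathEl hc, ghostPathEl_mul_pathSum hdpath hdlen hτ] at hmem
  refine ih _ ?_ ?_ ?_ hmem rfl
  · have hsub : (d.comapDomain (τ ++ ·) hinj'.injOn).support.image (τ ++ ·) ⊆
        d.support.erase ((σ ++ g :: ρ) ++ τ) := by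
      intro l hl
      obtain ⟨p, hp, rfl⟩ := Finset.mem_image.mp hl
      refine Finset.mem_erase.mpr ⟨fun h => hne ?_, by simpa using hp⟩
      simp only [hτdef, List.append_assoc, List.cons_append, List.append_cancel_left_eq,
        List.cons.injEq] at h
      exact h.1
    have hqd : (σ ++ g :: ρ) ++ τ ∈ d.support := by
      rw [Finsupp.mem_support_iff, hd, Finsupp.mapDomain_apply hinj _ (σ ++ g :: ρ)]
      exact Finsupp.mem_support_iff.mp hq
    rw [← Finset.card_image_of_injective _ hinj', ← hn]
    calc _ ≤ _ := Finset.card_le_card hsub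
      _ < d.support.card := Finset.card_erase_lt_of_mem hqd
      _ ≤ _ := (Finset.card_le_card Finsupp.mapDomain_support).trans Finset.card_image_le
  · intro p hp
    obtain ⟨u, hu, hp⟩ := isPath_append.mp (hdpath (τ ++ p) (by simpa using hp))
    exact hτ.unique hu ▸ hp
  · rw [Finsupp.comapDomain_apply, List.append_nil]
    have h := Finsupp.mapDomain_apply hinj c []
    rw [← hd, List.nil_append] at h
    rwa [h]

/-- A two-sided ideal of the Leavitt path algebra whose elements are all left quasi-regular in the
corners at the vertices is zero. -/
theorem eq_zero_of_mem_of_quasiRegular (hJ : J ⊆ lpa K s r)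
    (hqr : ∀ x ∈ J, ∀ v, vertexEl K s r v * x = x → x * vertexEl K s r v = x →
      ∃ y, y * (vertexEl K s r v + x) = vertexEl K s r v)
    (hl : ∀ x ∈ J, ∀ y ∈ lpa K s r, y * x ∈ J) (hr : ∀ x ∈ J, ∀ y ∈ lpa K s r, x * y ∈ J)
    {x : LPAU K s r} (hx : x ∈ J) : x = 0 := by
  by_contra hx0
  obtain ⟨w, u, hwu⟩ := exists_vertexEl_mul_mul_ne_zero (hJ hx) hx0
  obtain ⟨n, hn⟩ := exists_mem_ghostFiltration (hJ hx) w
  obtain ⟨y, hy, u', c, hc0, hc, hyc⟩ := exists_mul_eq_pathSum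
    (mul_vertexEl_mem_ghostFiltration hn u) hwu (u := u) (by rw [mul_assoc, vertexEl_mul_self])
  have hcJ : pathSum K s r w c ∈ J := hyc ▸
    hr _ (hr _ (hl _ hx _ (vertexEl_mem_lpa w)) _ (vertexEl_mem_lpa u)) _ hy
  obtain ⟨τ, hτ, hmin⟩ := c.support.exists_min_image List.length
    (Finsupp.support_nonempty_iff.mpr hc0)
  have hmem := hl _ hcJ _ (ghostPathEl_mem_lpa w τ)
  rw [ghostPathEl_mul_pathSum hc hmin (hc τ hτ)] at hmem
  refine false_of_pathSum_mem hqr hl hr ?_ ?_ hmem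
  · intro p hp
    obtain ⟨v, hv, hp⟩ := isPath_append.mp (hc (τ ++ p) (by simpa using hp))
    exact (hc τ hτ).unique hv ▸ hp
  · rw [Finsupp.comapDomain_apply, List.append_nil]
    exact Finsupp.mem_support_iff.mp hτ

end Radical

end LeavittPathAlgebra

/-- For any graph `E` and any field `K`, the Jacobson radical of the Leavitt path algebra
`L_K(E)` — the intersection of the annihilators of the simple left `L_K(E)`-modules — is
zero. -/
theorem jacobson_radical_zero (K V E : Type) [Field K] (s r : E → V) :
    {x : ↥(lpa K s r) |
        ∀ P : LeftMod ↥(lpa K s r), P.IsSimple → ∀ m : P.M, P.sm x m = 0} = {0} := by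
  ext x
  simp only [Set.mem_ofPred_eq, Set.mem_singleton_iff]
  constructor
  · intro hx
    let J : Set (LPAU K s r) := {x | ∃ h : x ∈ lpa K s r, ∀ P : LeftMod ↥(lpa K s r), P.IsSimple →
      ∀ m : P.M, P.sm ⟨x, h⟩ m = 0}
    apply Subtype.ext
    refine eq_zero_of_mem_of_quasiRegular (J := J) (fun x hx => hx.1) ?_ ?_ ?_ ⟨x.2, hx⟩
    · rintro x ⟨hx, hann⟩ v hvx hxv
      obtain ⟨y, hy⟩ := exists_mul_add_eq_of_annihilates (u := vertexIn K s r v) hann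
        (Subtype.ext (vertexEl_mul_self v)) (Subtype.ext hvx) (Subtype.ext hxv)
      exact ⟨y, congrArg Subtype.val hy⟩
    · rintro x ⟨hx, hann⟩ y hy
      refine ⟨mul_mem hy hx, fun P hP m => ?_⟩
      have h0 : P.sm ⟨y, hy⟩ 0 = 0 := by
        simpa using P.sm_add ⟨y, hy⟩ 0 0
      have h := P.mul_sm ⟨y, hy⟩ ⟨x, hx⟩ m
      rw [hann P hP, h0] at h
      exact h
    · rintro x ⟨hx, hann⟩ y hy
      refine ⟨mul_mem hx hy, fun P hP m => ?_⟩
      have h := P.mul_sm ⟨x, hx⟩ ⟨y, hy⟩ m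
      rw [hann P hP] at h
      exact h
  · rintro rfl P - m
    simpa using P.add_sm 0 0 m
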